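/- arXiv:1108.1257 — 4 statements merged into one kernel-verified Lean document; each statement's English description precedes it below -/
import Mathlib

section
/- For every real number λ > 0 and every integer m ≥ 1, the expectation of min(N, m) for a Poisson random variable N with parameter λ satisfies ∑_{i=0}^{∞} min(i, m) · (λ^i / i!) · e^{−λ} = m + (m / m!) · ( λ·Γ(m, λ) − Γ(m+1, λ) ), and in particular the series on the left converges. -/
open MeasureTheory

/-- Upper incomplete gamma function `Γ(s, x) = ∫_x^∞ t^{s-1} e^{-t} dt`. -/
noncomputable def incGamma (s x : ℝ) : ℝ := ∫ t in Set.Ioi x, t ^ (s - 1) * Real.exp (-t)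

noncomputable def gaux (x : ℝ) : ℕ → ℝ
  | 0 => Real.exp (-x)
  | n + 1 => x ^ (n + 1) * Real.exp (-x) + (n + 1) * gaux x n

theorem gaux_eq (x : ℝ) (n : ℕ) : gaux x n =
    (Nat.factorial n : ℝ) * Real.exp (-x) *
      ∑ k ∈ Finset.range (n + 1), x ^ k / (Nat.factorial k : ℝ) := by
  induction n with
  | zero => simp [gaux]
  | succ n ih =>
    rw [Finset.sum_range_succ, gaux, ih, mul_add, Nat.factorial_succ]
    have : (Nat.factorial n : ℝ) ≠ 0 := by positivity
    have : (n : ℝ) + 1 ≠ 0 := by positivity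
    push_cast
    field_simp
    ring

theorem gaux_deriv (n : ℕ) (x : ℝ) :
    HasDerivAt (fun y => - gaux y n) (x ^ n * Real.exp (-x)) x := by
  have he : HasDerivAt (fun y : ℝ => Real.exp (-y)) (Real.exp (-x) * (-1)) x :=
    (hasDerivAt_neg x).exp
  induction n with
  | zero =>
    have h := he.fun_neg
    have e : x ^ 0 * Real.exp (-x) = -(Real.exp (-x) * (-1)) := by ring
    rw [e]
    exact h
  | succ n ih =>
    have h := (((hasDerivAt_pow (n + 1) x).mul he).neg).add (ih.const_mul ((n : ℝ) + 1))
    refine (h.congr_deriv ?_).congr_of_eventuallyEq (Filter.Eventually.of_forall fun y => ?_)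
    · simp
      ring
    · simp [gaux]
      ring

theorem gaux_tendsto (n : ℕ) :
    Filter.Tendsto (fun y => - gaux y n) Filter.atTop (nhds 0) := by
  induction n with
  | zero =>
    have := (Real.tendsto_pow_mul_exp_neg_atTop_nhds_zero 0).neg
    simpa [gaux] using this
  | succ n ih =>
    have h := ((Real.tendsto_pow_mul_exp_neg_atTop_nhds_zero (n + 1)).neg).add
      (ih.const_mul ((n : ℝ) + 1))
    simp only [neg_zero, mul_zero, add_zero] at h
    refine h.congr fun y => ?_
    simp [gaux]
    ring

theorem incGamma_nat (n : ℕ) (x : ℝ) (hx : 0 < x) : incGamma ((n : ℝ) + 1) x = gaux x n := by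
  have h := integral_Ioi_of_hasDerivAt_of_nonneg' (a := x) (fun y _ => gaux_deriv n y)
    (fun y hy => mul_nonneg (pow_nonneg (hx.trans hy).le n) (Real.exp_pos _).le) (gaux_tendsto n)
  simpa [incGamma] using h

theorem fin_id (x : ℝ) (m : ℕ) :
    ∑ i ∈ Finset.range m, ((m : ℝ) - i) * (x ^ i / (Nat.factorial i : ℝ)) =
      m * ∑ i ∈ Finset.range (m + 1), x ^ i / (Nat.factorial i : ℝ)
        - x * ∑ i ∈ Finset.range m, x ^ i / (Nat.factorial i : ℝ) := by
  induction m with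
  | zero => simp
  | succ m ih =>
    have h1 : ∑ i ∈ Finset.range (m + 1), (((m + 1 : ℕ) : ℝ) - i) * (x ^ i / (Nat.factorial i : ℝ))
        = ∑ i ∈ Finset.range m, ((m : ℝ) - i) * (x ^ i / (Nat.factorial i : ℝ))
          + ∑ i ∈ Finset.range (m + 1), x ^ i / (Nat.factorial i : ℝ) := by
      rw [Finset.sum_range_succ, Finset.sum_range_succ _ m, ← add_assoc, ← Finset.sum_add_distrib]
      congr 1
      · refine Finset.sum_congr rfl fun i _ => ?_
        push_cast
        ring
      · push_cast
        ring
    rw [h1, ih, Finset.sum_range_succ _ (m + 1), Finset.sum_range_succ _ m, Nat.factorial_succ]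
    have : (Nat.factorial m : ℝ) ≠ 0 := by positivity
    have : (m : ℝ) + 1 ≠ 0 := by positivity
    push_cast
    field_simp
    ring

/-- The expectation of `min(N, m)` for a Poisson random variable `N` of parameter `λ`:
the series converges, with sum `m + (m/m!)·(λ·Γ(m,λ) − Γ(m+1,λ))`. -/
theorem poisson_expectation_min (lam : ℝ) (hlam : 0 < lam) (m : ℕ) (hm : 1 ≤ m) :
    HasSum (fun i : ℕ => (min i m : ℕ) * (lam ^ i / (Nat.factorial i : ℝ)) * Real.exp (-lam))
      ((m : ℝ) + (m : ℝ) / (Nat.factorial m : ℝ) *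
        (lam * incGamma (m : ℝ) lam - incGamma ((m : ℝ) + 1) lam)) := by
  have hE : HasSum (fun i : ℕ => lam ^ i / (Nat.factorial i : ℝ)) (Real.exp lam) := by
    rw [Real.exp_eq_exp_ℝ]
    exact NormedSpace.expSeries_div_hasSum_exp lam
  have hF : HasSum (fun i : ℕ => if i < m then
      ((m : ℝ) - i) * (lam ^ i / (Nat.factorial i : ℝ)) else 0)
      (∑ i ∈ Finset.range m, ((m : ℝ) - i) * (lam ^ i / (Nat.factorial i : ℝ))) := by
    have := hasSum_sum_of_ne_finset_zero (L := SummationFilter.unconditional ℕ) (s := Finset.range m) (f := fun i : ℕ => if i < m then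
      ((m : ℝ) - i) * (lam ^ i / (Nat.factorial i : ℝ)) else 0)
      (fun i hi => by simp at hi; simp [hi])
    convert this using 1
    refine Finset.sum_congr rfl fun i hi => ?_
    rw [if_pos (Finset.mem_range.1 hi)]
  have hS := ((hE.mul_left (m : ℝ)).sub hF).mul_right (Real.exp (-lam))
  have hf : (fun i : ℕ => (min i m : ℕ) * (lam ^ i / (Nat.factorial i : ℝ)) * Real.exp (-lam)) =
      fun i : ℕ => ((m : ℝ) * (lam ^ i / (Nat.factorial i : ℝ)) - if i < m then
      ((m : ℝ) - i) * (lam ^ i / (Nat.factorial i : ℝ)) else 0) * Real.exp (-lam) := by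
    funext i
    congr 1
    by_cases h : i < m
    · rw [if_pos h, min_eq_left h.le]
      ring
    · rw [if_neg h, min_eq_right (not_lt.1 h)]
      ring
  rw [hf]
  refine (congrArg (HasSum _ ·) ?_).mpr hS
  · rw [fin_id, incGamma_nat m lam hlam, gaux_eq]
    obtain ⟨n, rfl⟩ : ∃ n, m = n + 1 := ⟨m - 1, by omega⟩
    have h2 := incGamma_nat n lam hlam
    rw [gaux_eq] at h2
    push_cast at h2 ⊢
    rw [h2, Nat.factorial_succ]
    have h3 : Real.exp lam * Real.exp (-lam) = 1 := by rw [← Real.exp_add]; simp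
    have h4 : (Nat.factorial n : ℝ) ≠ 0 := by positivity
    have h5 : (n : ℝ) + 1 ≠ 0 := by positivity
    generalize ∑ k ∈ Finset.range (n + 1), lam ^ k / (Nat.factorial k : ℝ) = A
    generalize ∑ k ∈ Finset.range (n + 1 + 1), lam ^ k / (Nat.factorial k : ℝ) = B
    generalize Real.exp (-lam) = e at *
    push_cast
    field_simp
    linear_combination (-(n : ℝ) - 1) * h3
end

section
/- Let α > 2, c > 0 and r > 0 be real numbers. Then ∫_r^∞ (1 − e^{−c·x^{−α}})·x dx = −r²/2 + (c^{2/α}/α)·( Γ(−2/α, c·r^{−α}) − Γ(−2/α) ), where Γ(−2/α) denotes the value at −2/α of the Gamma function (extended to negative non-integer arguments, as in Mathlib's Real.Gamma). -/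
open MeasureTheory

open Filter Topology in
theorem aux_rec (s X : ℝ) (hs : -1 < s) (hX : 0 < X) :
    (∫ t in Set.Ioi X, t ^ s * Real.exp (-t)) = s * incGamma s X + X ^ s * Real.exp (-X) := by
  have i1 : IntegrableOn (fun t : ℝ => t ^ s * Real.exp (-t)) (Set.Ioi X) := by
    have := (Real.GammaIntegral_convergent (s := s + 1) (by linarith)).mono_set
      (Set.Ioi_subset_Ioi hX.le)
    simpa [mul_comm] using this
  have i2 : IntegrableOn (fun t : ℝ => t ^ (s - 1) * Real.exp (-t)) (Set.Ioi X) := by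
    refine Integrable.mono' (i1.const_mul X⁻¹) ?_ ?_
    · refine ContinuousOn.aestronglyMeasurable ?_ measurableSet_Ioi
      intro t ht
      have : 0 < t := hX.trans ht
      exact ((Real.continuousAt_rpow_const _ _ (Or.inl this.ne')).mul
        (by fun_prop)).continuousWithinAt
    · refine (ae_restrict_iff' measurableSet_Ioi).2 (Eventually.of_forall fun t ht => ?_)
      have ht' : X < t := ht
      have h0 : 0 < t := hX.trans ht
      rw [Real.norm_of_nonneg (by positivity), Real.rpow_sub_one h0.ne', div_eq_inv_mul, mul_assoc]
      gcongr
  have key := integral_Ioi_of_hasDerivAt_of_tendsto' (a := X) (m := 0)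
    (f := fun t : ℝ => t ^ s * Real.exp (-t))
    (f' := fun t : ℝ => s * (t ^ (s - 1) * Real.exp (-t)) - t ^ s * Real.exp (-t))
    (by
      intro t ht
      have h0 : 0 < t := lt_of_lt_of_le hX ht
      have := (Real.hasDerivAt_rpow_const (x := t) (p := s) (Or.inl h0.ne')).mul
        ((hasDerivAt_neg t).exp)
      refine this.congr_deriv ?_
      ring)
    ((i2.const_mul s).sub i1)
    (by simpa using tendsto_rpow_mul_exp_neg_mul_atTop_nhds_zero s 1 one_pos)
  rw [integral_sub (i2.const_mul s) i1, integral_const_mul] at key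
  unfold incGamma
  linarith

/-- Radial integral arising in the Laplace transform of the aggregate macrocell
interference outside a disk of radius `r`. -/
theorem radial_integral_outside_disk (α c r : ℝ) (hα : 2 < α) (hc : 0 < c) (hr : 0 < r) :
    ∫ x in Set.Ioi r, (1 - Real.exp (-c * x ^ (-α))) * x
      = -r ^ 2 / 2 + c ^ (2 / α) / α *
          (incGamma (-2 / α) (c * r ^ (-α)) - Real.Gamma (-2 / α)) := by
  have hα0 : 0 < α := by linarith
  obtain ⟨s, hs⟩ : ∃ s, s = -2 / α := ⟨_, rfl⟩
  have hs1 : -1 < s := by rw [hs, lt_div_iff₀ hα0]; linarith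
  have hs0 : s < 0 := by rw [hs]; exact div_neg_of_neg_of_pos (by norm_num) hα0
  have hsα : s * α = -2 := by rw [hs]; field_simp
  have hs2 : 2 / α = -s := by rw [hs]; ring
  rw [← hs, hs2]
  have hG : Real.Gamma (s + 1) = s * Real.Gamma s := Real.Gamma_add_one hs0.ne
  have i0 : IntegrableOn (fun t : ℝ => t ^ s * Real.exp (-t)) (Set.Ioi 0) := by
    have := (Real.GammaIntegral_convergent (s := s + 1) (by linarith))
    simpa [mul_comm] using this
  have ii : ∀ a b : ℝ, 0 ≤ a → 0 ≤ b →
      IntervalIntegrable (fun t : ℝ => t ^ s * Real.exp (-t)) volume a b := by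
    intro a b ha hb
    rw [intervalIntegrable_iff]
    exact i0.mono_set fun t ht => lt_of_le_of_lt (le_min ha hb) ht.1
  have hsplit : ∀ y : ℝ, 0 < y → (∫ t in (0:ℝ)..y, t ^ s * Real.exp (-t))
      = s * Real.Gamma s - (s * incGamma s y + y ^ s * Real.exp (-y)) := by
    intro y hy
    rw [← aux_rec s y hs1 hy, ← hG, Real.Gamma_eq_integral (by linarith)]
    have := intervalIntegral.integral_interval_add_Ioi (f := fun t : ℝ => t ^ s * Real.exp (-t))
      (μ := volume) (a := 0) (b := y) i0 (i0.mono_set (Set.Ioi_subset_Ioi hy.le))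
    have e : (∫ x in Set.Ioi (0:ℝ), Real.exp (-x) * x ^ (s + 1 - 1))
      = ∫ t in Set.Ioi (0:ℝ), t ^ s * Real.exp (-t) := by
      simp [mul_comm]
    rw [e]; linarith
  have hpow : ∀ x : ℝ, 0 < x → c ^ (-s) * (c * x ^ (-α)) ^ s = x ^ 2 := by
    intro x hx
    rw [Real.mul_rpow hc.le (by positivity), ← mul_assoc, ← Real.rpow_add hc, ← Real.rpow_mul hx.le]
    have : -α * s = (2:ℕ) := by push_cast; linarith
    rw [this, Real.rpow_natCast]; simp
  have hd : ∀ x ∈ Set.Ici r, HasDerivAt (fun x : ℝ => x ^ 2 / 2 * (1 - Real.exp (-c * x ^ (-α)))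
      + c ^ (-s) / (α * s) * ∫ t in (0:ℝ)..(c * x ^ (-α)), t ^ s * Real.exp (-t))
      ((1 - Real.exp (-c * x ^ (-α))) * x) x := by
    intro x hx
    have hx0 : 0 < x := lt_of_lt_of_le hr hx
    have hy : 0 < c * x ^ (-α) := by positivity
    have h1 := (Real.hasDerivAt_rpow_const (x := x) (p := -α) (Or.inl hx0.ne'))
    have hF : HasDerivAt (fun y : ℝ => ∫ t in (0:ℝ)..y, t ^ s * Real.exp (-t))
        ((c * x ^ (-α)) ^ s * Real.exp (-(c * x ^ (-α)))) (c * x ^ (-α)) := by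
      refine intervalIntegral.integral_hasDerivAt_right (ii _ _ le_rfl hy.le) ?_ ?_
      · exact (by fun_prop : Measurable fun t : ℝ => t ^ s * Real.exp (-t)).stronglyMeasurable.stronglyMeasurableAtFilter
      · exact (Real.continuousAt_rpow_const _ _ (Or.inl hy.ne')).mul (by fun_prop)
    have h2 := (hF.comp x (h1.const_mul c)).const_mul (c ^ (-s) / (α * s))
    have h3 := ((hasDerivAt_pow 2 x).div_const 2).mul (((h1.const_mul (-c)).exp).const_sub 1)
    refine (h3.add h2).congr_deriv ?_
    have e1 : c ^ (-s) / (α * s) = - c ^ (-s) / 2 := by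
      rw [mul_comm α s, hsα]; ring
    rw [e1]
    have e2 := hpow x hx0
    rw [show -(c * x ^ (-α)) = -c * x ^ (-α) by ring]
    generalize (c * x ^ (-α)) ^ s = Y at *
    generalize Real.exp (-c * x ^ (-α)) = E at *
    rw [← e2]
    push_cast
    ring
  have hlim : Filter.Tendsto (fun x : ℝ => x ^ 2 / 2 * (1 - Real.exp (-c * x ^ (-α)))
      + c ^ (-s) / (α * s) * ∫ t in (0:ℝ)..(c * x ^ (-α)), t ^ s * Real.exp (-t))
      Filter.atTop (nhds 0) := by
    have hA : Filter.Tendsto (fun x : ℝ => x ^ 2 / 2 * (1 - Real.exp (-c * x ^ (-α))))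
        Filter.atTop (nhds 0) := by
      have hb : Filter.Tendsto (fun x : ℝ => c / 2 * x ^ (-(α - 2))) Filter.atTop (nhds 0) := by
        simpa using (tendsto_rpow_neg_atTop (y := α - 2) (by linarith)).const_mul (c / 2)
      refine tendsto_of_tendsto_of_tendsto_of_le_of_le' tendsto_const_nhds hb ?_ ?_
      · filter_upwards [Filter.eventually_gt_atTop 0] with x hx
        have : Real.exp (-c * x ^ (-α)) ≤ 1 := by
          rw [Real.exp_le_one_iff]
          have : 0 < c * x ^ (-α) := by positivity
          linarith
        have : 0 ≤ 1 - Real.exp (-c * x ^ (-α)) := by linarith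
        positivity
      · filter_upwards [Filter.eventually_gt_atTop 0] with x hx
        have h1 := Real.add_one_le_exp (-c * x ^ (-α))
        have h2 : x ^ (-(α - 2)) = x ^ 2 * x ^ (-α) := by
          rw [← Real.rpow_natCast, ← Real.rpow_add hx]; congr 1; push_cast; ring
        rw [h2]
        calc x ^ 2 / 2 * (1 - Real.exp (-c * x ^ (-α))) ≤ x ^ 2 / 2 * (c * x ^ (-α)) := by
              gcongr; linarith
          _ = _ := by ring
    have hy : Filter.Tendsto (fun x : ℝ => c * x ^ (-α)) Filter.atTop (nhdsWithin 0 (Set.Icc 0 1)) := by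
      have h0 : Filter.Tendsto (fun x : ℝ => c * x ^ (-α)) Filter.atTop (nhds 0) := by
        simpa using (tendsto_rpow_neg_atTop hα0).const_mul c
      refine tendsto_nhdsWithin_iff.2 ⟨h0, ?_⟩
      filter_upwards [Filter.eventually_gt_atTop 0, h0.eventually_le_const one_pos] with x hx h1
      exact ⟨by positivity, h1⟩
    have hc0 := intervalIntegral.continuousOn_primitive_interval (a := 0) (b := 1) (μ := volume)
      (f := fun t : ℝ => t ^ s * Real.exp (-t))
      (by
        rw [Set.uIcc_of_le zero_le_one, integrableOn_Icc_iff_integrableOn_Ioc]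
        exact i0.mono_set fun t ht => ht.1)
    rw [Set.uIcc_of_le zero_le_one] at hc0
    have hB := (hc0 0 (by simp)).tendsto.comp hy
    simp only [intervalIntegral.integral_same] at hB
    simpa using hA.add (hB.const_mul (c ^ (-s) / (α * s)))
  rw [integral_Ioi_of_hasDerivAt_of_nonneg' hd ?_ hlim, hsplit _ (by positivity)]
  · have e2 := hpow r hr
    have e1 : c ^ (-s) / (α * s) = - c ^ (-s) / 2 := by
      rw [mul_comm α s, hsα]; ring
    have e3 : c ^ (-s) / α = - s * c ^ (-s) / 2 := by
      rw [div_eq_div_iff hα0.ne' two_ne_zero]; linear_combination c ^ (-s) * hsα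
    rw [e1, e3, show -(c * r ^ (-α)) = -c * r ^ (-α) by ring]
    generalize (c * r ^ (-α)) ^ s = Y at *
    rw [← e2]
    ring
  · intro x hx
    have hx0 : 0 < x := hr.trans hx
    have : Real.exp (-c * x ^ (-α)) ≤ 1 := by
      rw [Real.exp_le_one_iff]
      have : 0 < c * x ^ (-α) := by positivity
      linarith
    exact mul_nonneg (by linarith) hx0.le
end

section
/- Let α > 2 and c > 0 be real numbers. Then ∫_0^∞ (1 − e^{−c·x^{−α}})·x dx = (c^{2/α}/2)·Γ(1 − 2/α), where Γ denotes the Gamma function. -/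
open MeasureTheory

open Set Filter Topology in
theorem aux_parts (p c : ℝ) (hp : 0 < p) (hp1 : p < 1) (hc : 0 < c) :
    ∫ t in Set.Ioi (0 : ℝ), (1 - Real.exp (-c * t)) * (-p * t ^ (-p - 1))
      = - (c ^ p * Real.Gamma (1 - p)) := by
  have hb1 : ∀ t : ℝ, 0 < t → 0 ≤ 1 - Real.exp (-c * t) := fun t ht => by
    have : Real.exp (-c * t) ≤ 1 := Real.exp_le_one_iff.2 (by nlinarith)
    linarith
  have hb2 : ∀ t : ℝ, 1 - Real.exp (-c * t) ≤ c * t := fun t => by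
    have := Real.add_one_le_exp (-c * t)
    linarith
  have hb3 : ∀ t : ℝ, 1 - Real.exp (-c * t) ≤ 1 := fun t => by
    have := Real.exp_pos (-c * t)
    linarith
  have hint : IntegrableOn (fun t : ℝ => t ^ (-p) * Real.exp (-c * t)) (Ioi 0) := by
    simpa using integrableOn_rpow_mul_exp_neg_mul_rpow (p := 1) (s := -p) (b := c)
      (by linarith) one_pos hc
  have hval : ∫ t in Ioi (0 : ℝ), t ^ (-p) * Real.exp (-c * t)
      = c ^ (p - 1) * Real.Gamma (1 - p) := by
    have := integral_rpow_mul_exp_neg_mul_rpow (p := 1) (q := -p) (b := c)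
      one_pos (by linarith) hc
    simp only [Real.rpow_one, div_one, mul_one] at this
    rw [this]
    congr 2 <;> ring
  have hmeas : ∀ s : Set ℝ, MeasurableSet s → s ⊆ Ioi 0 → AEStronglyMeasurable
      (fun t : ℝ => (1 - Real.exp (-c * t)) * (-p * t ^ (-p - 1))) (volume.restrict s) := by
    intro s _ _
    exact Measurable.aestronglyMeasurable (by fun_prop)
  have key := integral_Ioi_mul_deriv_eq_deriv_mul (a := (0:ℝ)) (a' := (0:ℝ)) (b' := (0:ℝ))
    (u := fun t : ℝ => 1 - Real.exp (-c * t)) (u' := fun t => c * Real.exp (-c * t))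
    (v := fun t : ℝ => t ^ (-p)) (v' := fun t => -p * t ^ (-p - 1))
    ?_ ?_ ?_ ?_ ?_ ?_
  · rw [key]
    have : ∫ t in Ioi (0 : ℝ), c * Real.exp (-c * t) * t ^ (-p)
        = c * ∫ t in Ioi (0 : ℝ), t ^ (-p) * Real.exp (-c * t) := by
      rw [← integral_const_mul]
      congr 1; ext t; ring
    rw [this, hval, Real.rpow_sub hc, Real.rpow_one]
    field_simp
    ring
  · intro t _
    have h := ((((hasDerivAt_id t).const_mul (-c)).exp).const_sub 1)
    have e : c * Real.exp (-c * t) = -(Real.exp (-c * id t) * (-c * 1)) := by simp only [id]; ring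
    exact e ▸ h
  · intro t ht
    exact Real.hasDerivAt_rpow_const (Or.inl (ne_of_gt ht))
  · rw [← Ioc_union_Ioi_eq_Ioi (zero_le_one' ℝ)]
    apply IntegrableOn.union
    · have h1 : IntegrableOn (fun t : ℝ => p * c * t ^ (-p)) (Ioc 0 1) := by
        apply Integrable.const_mul
        exact (intervalIntegrable_iff_integrableOn_Ioc_of_le zero_le_one).1
          (intervalIntegral.intervalIntegrable_rpow' (by linarith))
      refine Integrable.mono' h1 (hmeas _ measurableSet_Ioc (fun x hx => hx.1)) ?_
      refine ae_restrict_of_forall_mem measurableSet_Ioc fun t ht => ?_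
      have h0 := hb1 t ht.1
      have hr := Real.rpow_pos_of_pos ht.1 (-p - 1)
      have e : t ^ (-p) = t * t ^ (-p - 1) := by
        rw [Real.rpow_sub_one ht.1.ne']; field_simp [ht.1.ne']
      simp only [Pi.mul_apply, norm_mul, norm_neg, Real.norm_eq_abs, abs_of_nonneg h0,
        abs_of_pos hp, abs_of_pos hr, e]
      have := mul_le_mul_of_nonneg_right (hb2 t) (mul_pos hp hr).le
      linarith
    · have h1 : IntegrableOn (fun t : ℝ => p * t ^ (-p - 1)) (Ioi 1) :=
        Integrable.const_mul (integrableOn_Ioi_rpow_of_lt (by linarith) one_pos) _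
      refine Integrable.mono' h1 (hmeas _ measurableSet_Ioi (Ioi_subset_Ioi zero_le_one)) ?_
      refine ae_restrict_of_forall_mem measurableSet_Ioi fun t ht => ?_
      have ht0 : 0 < t := zero_lt_one.trans ht
      have h0 := hb1 t ht0
      have hr := Real.rpow_pos_of_pos ht0 (-p - 1)
      simp only [Pi.mul_apply, norm_mul, norm_neg, Real.norm_eq_abs, abs_of_nonneg h0,
        abs_of_pos hp, abs_of_pos hr]
      have := mul_le_mul_of_nonneg_right (hb3 t) (mul_pos hp hr).le
      linarith
  · refine (hint.const_mul c).congr (ae_of_all _ fun t => ?_)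
    simp only [Pi.mul_apply]; ring
  · have hT : Tendsto (fun t : ℝ => c * t ^ (1 - p)) (𝓝[>] 0) (𝓝 0) := by
      have h := ((Real.continuousAt_rpow_const (0:ℝ) (1 - p)
        (Or.inr (by linarith))).tendsto.const_mul c)
      rw [Real.zero_rpow (by linarith), mul_zero] at h
      exact h.mono_left nhdsWithin_le_nhds
    refine tendsto_of_tendsto_of_tendsto_of_le_of_le' tendsto_const_nhds hT ?_ ?_
    · filter_upwards [self_mem_nhdsWithin] with t ht
      exact mul_nonneg (hb1 t ht) (Real.rpow_nonneg (le_of_lt ht) _)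
    · filter_upwards [self_mem_nhdsWithin] with t ht
      have ht0 : 0 < t := ht
      have e : t ^ (1 - p) = t * t ^ (-p) := by
        rw [sub_eq_add_neg, Real.rpow_add ht0, Real.rpow_one]
      have := mul_le_mul_of_nonneg_right (hb2 t) (Real.rpow_nonneg ht0.le (-p))
      simp only [Pi.mul_apply, e]
      linarith
  · refine tendsto_of_tendsto_of_tendsto_of_le_of_le' tendsto_const_nhds
      (tendsto_rpow_neg_atTop hp) ?_ ?_
    · filter_upwards [eventually_gt_atTop 0] with t ht
      exact mul_nonneg (hb1 t ht) (Real.rpow_nonneg (le_of_lt ht) _)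
    · filter_upwards [eventually_gt_atTop 0] with t ht
      have := mul_le_mul_of_nonneg_right (hb3 t) (Real.rpow_nonneg ht.le (-p))
      simp only [Pi.mul_apply]
      linarith

/-- Whole-plane radial integral arising in the Laplace transform of the aggregate
femtocell interference. -/
theorem radial_integral_whole_plane (α c : ℝ) (hα : 2 < α) (hc : 0 < c) :
    ∫ x in Set.Ioi (0 : ℝ), (1 - Real.exp (-c * x ^ (-α))) * x
      = c ^ (2 / α) / 2 * Real.Gamma (1 - 2 / α) := by
  have hα0 : 0 < α := by linarith
  have h1 := aux_parts (2 / α) c (by positivity) ((div_lt_one hα0).2 hα) hc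
  rw [← integral_comp_rpow_Ioi _ (neg_ne_zero.2 hα0.ne')] at h1
  have h2 : ∫ x in Set.Ioi (0 : ℝ), (|(-α)| * x ^ (-α - 1)) •
      ((1 - Real.exp (-c * x ^ (-α))) * (-(2 / α) * (x ^ (-α)) ^ (-(2 / α) - 1)))
      = ∫ x in Set.Ioi (0 : ℝ), (-2) * ((1 - Real.exp (-c * x ^ (-α))) * x) := by
    refine setIntegral_congr_fun measurableSet_Ioi fun x hx => ?_
    have hx0 : 0 < x := hx
    have e : x ^ (-α - 1) * (x ^ (-α)) ^ (-(2 / α) - 1) = x := by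
      rw [← Real.rpow_mul hx0.le, ← Real.rpow_add hx0]
      have : -α - 1 + -α * (-(2 / α) - 1) = 1 := by field_simp; ring
      rw [this, Real.rpow_one]
    simp only [smul_eq_mul, abs_neg, abs_of_pos hα0]
    calc _ = (α * (2 / α)) * (-(1 - Real.exp (-c * x ^ (-α)))) *
          (x ^ (-α - 1) * (x ^ (-α)) ^ (-(2 / α) - 1)) := by ring
      _ = _ := by rw [e, mul_div_cancel₀ _ hα0.ne']; ring
  rw [h2, integral_const_mul] at h1
  linarith
end

section
/- Let ρ > 0 and L > 0 be real numbers. Then (1/L) · ∫_0^L ∫_0^∞ exp( −ρ·√(e^t − 1)·v ) dt dv = 2 · ∫_0^∞ (1 − e^{−y}) / ( y² + ρ²·L² ) dy. -/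
open MeasureTheory

lemma aux_integrable (c : ℝ) (hc : 0 < c) :
    IntegrableOn (fun y : ℝ => (1 - Real.exp (-y)) / (y ^ 2 + c ^ 2)) (Set.Ioi 0) := by
  have h1 : IntegrableOn (fun y : ℝ => (1 + 1 / c ^ 2) * (1 + y ^ 2)⁻¹) (Set.Ioi 0) :=
    (integrable_inv_one_add_sq.const_mul _).integrableOn
  refine Integrable.mono' h1 ?_ ?_
  · apply Measurable.aestronglyMeasurable
    fun_prop
  · refine (ae_restrict_iff' measurableSet_Ioi).2 (Filter.Eventually.of_forall fun y hy => ?_)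
    have hy : 0 < y := hy
    have h2 : Real.exp (-y) ≤ 1 := Real.exp_le_one_iff.2 (by linarith)
    have h3 := Real.exp_pos (-y)
    rw [Real.norm_of_nonneg (div_nonneg (by linarith) (by positivity)), ← div_eq_mul_inv,
      div_le_div_iff₀ (by positivity) (by positivity)]
    have h4 : (1 + 1 / c ^ 2) * (y ^ 2 + c ^ 2) = y ^ 2 + c ^ 2 + y ^ 2 / c ^ 2 + 1 := by
      field_simp
      ring
    rw [h4]
    have : 0 ≤ y ^ 2 / c ^ 2 := by positivity
    nlinarith [sq_nonneg y, sq_nonneg c]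

lemma aux_image (c : ℝ) (hc : 0 < c) :
    (fun y : ℝ => Real.log (1 + (y / c) ^ 2)) '' Set.Ioi 0 = Set.Ioi 0 := by
  ext t
  constructor
  · rintro ⟨y, hy, rfl⟩
    have hy : 0 < y := hy
    apply Real.log_pos
    have : 0 < (y / c) ^ 2 := by positivity
    linarith
  · intro ht
    have ht : 0 < t := ht
    have h1 : 0 < Real.exp t - 1 := by linarith [Real.add_one_lt_exp ht.ne']
    refine ⟨c * Real.sqrt (Real.exp t - 1), mul_pos hc (Real.sqrt_pos.2 h1), ?_⟩
    simp only
    rw [mul_div_cancel_left₀ _ hc.ne', Real.sq_sqrt h1.le]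
    simp

lemma aux_inj (c : ℝ) (hc : 0 < c) :
    Set.InjOn (fun y : ℝ => Real.log (1 + (y / c) ^ 2)) (Set.Ioi 0) := by
  intro x hx y hy h
  have hx : 0 < x := hx
  have hy : 0 < y := hy
  have h := Real.log_injOn_pos (show (0:ℝ) < _ by positivity) (show (0:ℝ) < _ by positivity) h
  have h2 : (x / c) ^ 2 = (y / c) ^ 2 := by linarith
  have h3 := (pow_left_inj₀ (by positivity) (by positivity) two_ne_zero).1 h2
  field_simp at h3
  exact h3

lemma aux_deriv (c : ℝ) (hc : 0 < c) (y : ℝ) :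
    HasDerivAt (fun y : ℝ => Real.log (1 + (y / c) ^ 2)) (2 * y / (y ^ 2 + c ^ 2)) y := by
  have h0 : HasDerivAt (fun y : ℝ => 1 + (y / c) ^ 2) (2 * (y / c) * (1 / c)) y := by
    have h := (((hasDerivAt_id' y).div_const c).fun_pow 2).const_add 1
    exact h.congr_deriv (by norm_num)
  have h := h0.log (by positivity)
  refine h.congr_deriv ?_
  field_simp
  try ring

lemma aux_inner (ρ L s : ℝ) (hρ : 0 < ρ) (hs : 0 < s) :
    ∫ v in (0 : ℝ)..L, Real.exp (-ρ * s * v) = (1 - Real.exp (-(ρ * L * s))) / (ρ * s) := by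
  have hne : -ρ * s ≠ 0 := by
    have := mul_pos hρ hs
    intro h; linarith
  rw [intervalIntegral.integral_comp_mul_left (fun x => Real.exp x) hne, integral_exp]
  simp only [mul_zero, Real.exp_zero, smul_eq_mul]
  rw [show -ρ * s * L = -(ρ * L * s) by ring]
  field_simp
  ring

lemma aux_eqOn (ρ L : ℝ) (hρ : 0 < ρ) (hL : 0 < L) :
    Set.EqOn (fun y : ℝ => |2 * y / (y ^ 2 + (ρ * L) ^ 2)| •
      (fun t => (1 - Real.exp (-(ρ * L * Real.sqrt (Real.exp t - 1)))) /
        (ρ * Real.sqrt (Real.exp t - 1))) (Real.log (1 + (y / (ρ * L)) ^ 2)))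
      (fun y => 2 * L * ((1 - Real.exp (-y)) / (y ^ 2 + (ρ * L) ^ 2))) (Set.Ioi 0) := by
  intro y hy
  have hy : 0 < y := hy
  simp only [smul_eq_mul]
  rw [Real.exp_log (by positivity), add_sub_cancel_left, Real.sqrt_sq (by positivity),
    abs_of_nonneg (by positivity), mul_div_cancel₀ _ (by positivity)]
  field_simp

/-- Mean achievable rate of a femtocell user for path loss exponent 4 and zero noise:
`L = R_f²` and `ρ` aggregates the interference parameters. -/
theorem femtocell_mean_rate (ρ L : ℝ) (hρ : 0 < ρ) (hL : 0 < L) :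
    (1 / L) * ∫ v in (0 : ℝ)..L, ∫ t in Set.Ioi (0 : ℝ),
        Real.exp (-ρ * Real.sqrt (Real.exp t - 1) * v)
      = 2 * ∫ y in Set.Ioi (0 : ℝ), (1 - Real.exp (-y)) / (y ^ 2 + ρ ^ 2 * L ^ 2) := by
  have hc : 0 < ρ * L := mul_pos hρ hL
  set G : ℝ → ℝ := fun t => (1 - Real.exp (-(ρ * L * Real.sqrt (Real.exp t - 1)))) /
        (ρ * Real.sqrt (Real.exp t - 1)) with hG
  have hGint : IntegrableOn G (Set.Ioi 0) := by
    rw [← aux_image (ρ * L) hc, integrableOn_image_iff_integrableOn_abs_deriv_smul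
      measurableSet_Ioi (fun y _ => (aux_deriv (ρ * L) hc y).hasDerivWithinAt)
      (aux_inj (ρ * L) hc), integrableOn_congr_fun (aux_eqOn ρ L hρ hL) measurableSet_Ioi]
    exact (aux_integrable (ρ * L) hc).const_mul _
  have hGval : ∫ t in Set.Ioi (0:ℝ), G t =
      2 * L * ∫ y in Set.Ioi (0 : ℝ), (1 - Real.exp (-y)) / (y ^ 2 + (ρ * L) ^ 2) := by
    conv_lhs => rw [← aux_image (ρ * L) hc]
    rw [integral_image_eq_integral_abs_deriv_smul
      measurableSet_Ioi (fun y _ => (aux_deriv (ρ * L) hc y).hasDerivWithinAt)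
      (aux_inj (ρ * L) hc), setIntegral_congr_fun measurableSet_Ioi (aux_eqOn ρ L hρ hL),
      integral_const_mul]
  have hin : Set.EqOn (fun t => ∫ v in Set.Ioc (0 : ℝ) L,
      Real.exp (-ρ * Real.sqrt (Real.exp t - 1) * v)) G (Set.Ioi 0) := by
    intro t ht
    have ht : 0 < t := ht
    have h1 : 0 < Real.exp t - 1 := by linarith [Real.add_one_lt_exp ht.ne']
    simp only [hG]
    rw [← intervalIntegral.integral_of_le hL.le, aux_inner ρ L _ hρ (Real.sqrt_pos.2 h1)]
  have hint : Integrable (Function.uncurry fun v t : ℝ =>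
      Real.exp (-ρ * Real.sqrt (Real.exp t - 1) * v))
      ((volume.restrict (Set.Ioc 0 L)).prod (volume.restrict (Set.Ioi 0))) := by
    rw [integrable_prod_iff']
    · constructor
      · refine Filter.Eventually.of_forall fun t => ?_
        have : Continuous fun v : ℝ => Real.exp (-ρ * Real.sqrt (Real.exp t - 1) * v) := by
          fun_prop
        exact (this.integrableOn_Icc).mono_set Set.Ioc_subset_Icc_self
      · simp only [Function.uncurry, Real.norm_eq_abs, Real.abs_exp]
        exact (integrableOn_congr_fun hin measurableSet_Ioi).2 hGint
    · apply Continuous.aestronglyMeasurable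
      unfold Function.uncurry
      fun_prop
  rw [intervalIntegral.integral_of_le hL.le, integral_integral_swap hint,
    setIntegral_congr_fun measurableSet_Ioi hin, hGval]
  simp only [mul_pow]
  field_simp
end
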